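/- Let p ≤ 0 and q < 0 be real numbers, and let ν ≥ -1/q satisfy 4q(q-1)ν³ - (p² - 4(q-1))ν² - 2p²ν - p² ≥ 0. Then the function u ↦ u^{1-p}·I_ν'(u)·I_ν(u)^{q-1} is strictly decreasing on (0, ∞); equivalently, I_ν is strictly (p,q)-concave on (0, ∞). -/

import Mathlib

open Real MeasureTheory Set

/-- The modified Bessel function of the first kind of order `ν`. -/
noncomputable def besselI (ν u : ℝ) : ℝ :=
  ∑' n : ℕ, (u / 2) ^ (2 * (n : ℝ) + ν) / ((n.factorial : ℝ) * Real.Gamma ((n : ℝ) + ν + 1))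

/-- The coefficients of the entire part of the modified Bessel function of order `μ`. -/
noncomputable def besselCoeff (μ : ℝ) (n : ℕ) : ℝ :=
  ((n.factorial : ℝ) * Real.Gamma ((n : ℝ) + μ + 1))⁻¹

/-- The entire part `∑ xⁿ / (n! Γ(n + μ + 1))` of the modified Bessel function of order `μ`. -/
noncomputable def besselEntire (μ x : ℝ) : ℝ :=
  ∑' n : ℕ, besselCoeff μ n * x ^ n

lemma besselCoeff_pos {μ : ℝ} (hμ : 0 < μ) (n : ℕ) : 0 < besselCoeff μ n := by
  have : 0 < Real.Gamma ((n : ℝ) + μ + 1) := Real.Gamma_pos_of_pos (by positivity)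
  unfold besselCoeff
  positivity

lemma Gamma_le_Gamma_nat_add {μ : ℝ} (hμ : 0 < μ) (n : ℕ) :
    Real.Gamma (μ + 1) ≤ Real.Gamma ((n : ℝ) + μ + 1) := by
  induction n with
  | zero => simp
  | succ k ih =>
    have h : Real.Gamma ((k : ℝ) + μ + 1 + 1) = (k + μ + 1) * Real.Gamma (k + μ + 1) :=
      Real.Gamma_add_one (by positivity)
    have hpos : 0 < Real.Gamma ((k : ℝ) + μ + 1) := Real.Gamma_pos_of_pos (by positivity)
    have hk : (0 : ℝ) ≤ k := k.cast_nonneg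
    have e : ((k + 1 : ℕ) : ℝ) + μ + 1 = (k : ℝ) + μ + 1 + 1 := by push_cast; ring
    rw [e, h]
    nlinarith

lemma besselCoeff_le {μ : ℝ} (hμ : 0 < μ) (n : ℕ) :
    besselCoeff μ n ≤ (Real.Gamma (μ + 1))⁻¹ * (n.factorial : ℝ)⁻¹ := by
  have h0 : 0 < Real.Gamma (μ + 1) := Real.Gamma_pos_of_pos (by positivity)
  rw [besselCoeff, mul_inv, mul_comm]
  gcongr
  exact Gamma_le_Gamma_nat_add hμ n

lemma summable_besselCoeff {μ : ℝ} (hμ : 0 < μ) (x : ℝ) :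
    Summable fun n : ℕ => besselCoeff μ n * x ^ n := by
  refine Summable.of_norm_bounded
    ((Real.summable_pow_div_factorial |x|).mul_left (Real.Gamma (μ + 1))⁻¹) fun n => ?_
  rw [norm_mul, norm_pow, Real.norm_eq_abs, Real.norm_eq_abs, abs_of_pos (besselCoeff_pos hμ n)]
  calc besselCoeff μ n * |x| ^ n
      ≤ (Real.Gamma (μ + 1))⁻¹ * (n.factorial : ℝ)⁻¹ * |x| ^ n := by
        gcongr; exact besselCoeff_le hμ n
    _ = _ := by ring

lemma succ_mul_besselCoeff_succ (μ : ℝ) (n : ℕ) :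
    ((n : ℝ) + 1) * besselCoeff μ (n + 1) = besselCoeff (μ + 1) n := by
  have h : ((n : ℝ) + 1) ≠ 0 := by positivity
  have e : ((n + 1 : ℕ) : ℝ) + μ + 1 = (n : ℝ) + (μ + 1) + 1 := by push_cast; ring
  rw [besselCoeff, besselCoeff, Nat.factorial_succ, e, Nat.cast_mul, Nat.cast_succ]
  simp only [mul_inv]
  field_simp

lemma hasDerivAt_besselEntire {μ : ℝ} (hμ : 0 < μ) (x : ℝ) :
    HasDerivAt (besselEntire μ) (besselEntire (μ + 1) x) x := by
  have hx : x ∈ Metric.ball (0 : ℝ) (|x| + 1) := by simp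
  have hshift (z : ℝ) (n : ℕ) : besselCoeff μ (n + 1) * (((n + 1 : ℕ) : ℝ) * z ^ (n + 1 - 1)) =
      besselCoeff (μ + 1) n * z ^ n := by
    rw [← succ_mul_besselCoeff_succ]
    push_cast
    ring
  have hsum (z : ℝ) : Summable fun n : ℕ => besselCoeff μ n * ((n : ℝ) * z ^ (n - 1)) := by
    rw [← summable_nat_add_iff 1]
    simpa only [hshift] using summable_besselCoeff (by linarith : 0 < μ + 1) z
  have key := hasDerivAt_tsum_of_isPreconnected
    (g := fun (n : ℕ) (y : ℝ) => besselCoeff μ n * y ^ n)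
    (g' := fun (n : ℕ) (y : ℝ) => besselCoeff μ n * ((n : ℝ) * y ^ (n - 1)))
    (hsum (|x| + 1)) Metric.isOpen_ball (convex_ball (0 : ℝ) (|x| + 1)).isPreconnected
    (fun n y _ => (hasDerivAt_pow n y).const_mul _)
    (fun n y hy => by
      have hy' : |y| ≤ |x| + 1 := by simpa using (mem_ball_zero_iff.mp hy).le
      rw [norm_mul, norm_mul, norm_pow, Real.norm_eq_abs, Real.norm_eq_abs, Real.norm_eq_abs,
        abs_of_pos (besselCoeff_pos hμ n), Nat.abs_cast]
      have := besselCoeff_pos hμ n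
      gcongr)
    hx (summable_besselCoeff hμ x) hx
  refine key.congr_deriv ?_
  rw [(hsum x).tsum_eq_zero_add]
  simp only [hshift]
  simp [besselEntire]

lemma besselEntire_recurrence {μ : ℝ} (hμ : 0 < μ) (x : ℝ) :
    besselEntire μ x = (μ + 1) * besselEntire (μ + 1) x + x * besselEntire (μ + 2) x := by
  have h1 := summable_besselCoeff (by linarith : 0 < μ + 1) x
  have h2 := summable_besselCoeff (by linarith : 0 < μ + 2) x
  have hcoeff (n : ℕ) : besselCoeff μ n = (n + μ + 1) * besselCoeff (μ + 1) n := by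
    have hpos : (0 : ℝ) < n + μ + 1 := by positivity
    have e : (n : ℝ) + (μ + 1) + 1 = (n + μ + 1) + 1 := by ring
    rw [besselCoeff, besselCoeff, e, Real.Gamma_add_one hpos.ne']
    simp only [mul_inv]
    field_simp
  have hshift (n : ℕ) : ((n + 1 : ℕ) : ℝ) * besselCoeff (μ + 1) (n + 1) =
      besselCoeff (μ + 2) n := by
    have := succ_mul_besselCoeff_succ (μ + 1) n
    rw [show μ + 1 + 1 = μ + 2 by ring] at this
    rw [← this]; push_cast; ring
  have hterm (n : ℕ) : ((n + 1 : ℕ) : ℝ) * besselCoeff (μ + 1) (n + 1) * x ^ (n + 1) =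
      x * (besselCoeff (μ + 2) n * x ^ n) := by
    rw [hshift]; ring
  have hs : Summable fun n : ℕ => (n : ℝ) * besselCoeff (μ + 1) n * x ^ n := by
    rw [← summable_nat_add_iff 1]
    simpa only [hterm] using h2.mul_left x
  have h3 : ∑' n : ℕ, (n : ℝ) * besselCoeff (μ + 1) n * x ^ n = x * besselEntire (μ + 2) x := by
    rw [hs.tsum_eq_zero_add]
    simp only [hterm]
    simp [besselEntire, tsum_mul_left]
  rw [← h3, besselEntire, besselEntire, ← tsum_mul_left, ← (h1.mul_left _).tsum_add hs]
  refine tsum_congr fun n => ?_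
  rw [hcoeff]; ring

lemma besselEntire_pos {μ : ℝ} (hμ : 0 < μ) {x : ℝ} (hx : 0 ≤ x) : 0 < besselEntire μ x :=
  (summable_besselCoeff hμ x).tsum_pos
    (fun n => mul_nonneg (besselCoeff_pos hμ n).le (pow_nonneg hx n)) 0
    (by simpa using besselCoeff_pos hμ 0)

lemma besselI_eq_rpow_mul {μ : ℝ} (hμ : 0 < μ) {u : ℝ} (hu : 0 ≤ u) :
    besselI μ u = (u / 2) ^ μ * besselEntire μ ((u / 2) ^ 2) := by
  rw [besselI, besselEntire, ← tsum_mul_left]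
  refine tsum_congr fun n => ?_
  rw [Real.rpow_add_of_nonneg (by positivity) (by positivity) hμ.le, Real.rpow_mul (by positivity),
    Real.rpow_two, Real.rpow_natCast, besselCoeff, div_eq_mul_inv]
  ring

lemma besselI_pos {μ : ℝ} (hμ : 0 < μ) {u : ℝ} (hu : 0 < u) : 0 < besselI μ u := by
  rw [besselI_eq_rpow_mul hμ hu.le]
  have := besselEntire_pos hμ (sq_nonneg (u / 2))
  positivity

lemma besselI_zero {μ : ℝ} (hμ : 0 < μ) : besselI μ 0 = 0 := by
  simp [besselI_eq_rpow_mul hμ le_rfl, Real.zero_rpow hμ.ne']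

lemma continuousOn_besselI {μ : ℝ} (hμ : 0 < μ) : ContinuousOn (besselI μ) (Ici 0) := by
  have hE : Continuous (besselEntire μ) :=
    continuous_iff_continuousAt.2 fun x => (hasDerivAt_besselEntire hμ x).continuousAt
  have hr : Continuous fun u : ℝ => (u / 2) ^ μ :=
    (Real.continuous_rpow_const hμ.le).comp (continuous_id.div_const 2)
  exact (hr.mul (hE.comp ((continuous_id.div_const 2).pow 2))).continuousOn.congr
    fun u hu => besselI_eq_rpow_mul hμ hu

lemma hasDerivAt_besselI {μ : ℝ} (hμ : 0 < μ) {u : ℝ} (hu : 0 < u) :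
    HasDerivAt (besselI μ) (μ / u * besselI μ u + besselI (μ + 1) u) u := by
  have hhalf : HasDerivAt (fun v : ℝ => v / 2) (1 / 2) u := (hasDerivAt_id u).div_const 2
  have hr := hhalf.rpow_const (p := μ) (Or.inl (by positivity))
  have hE := (hasDerivAt_besselEntire hμ ((u / 2) ^ 2)).comp u (hhalf.pow 2)
  refine ((hr.mul hE).congr_of_eventuallyEq ?_).congr_deriv ?_
  · filter_upwards [Ioi_mem_nhds hu] with v hv
    exact besselI_eq_rpow_mul hμ (le_of_lt hv)
  · rw [besselI_eq_rpow_mul hμ hu.le, besselI_eq_rpow_mul (by linarith : 0 < μ + 1) hu.le,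
      Real.rpow_sub_one (by positivity), Real.rpow_add_one (by positivity)]
    simp only [Function.comp_apply, Pi.pow_apply]
    field_simp
    ring

lemma besselI_recurrence {μ : ℝ} (hμ : 0 < μ) {u : ℝ} (hu : 0 < u) :
    besselI μ u = 2 * (μ + 1) / u * besselI (μ + 1) u + besselI (μ + 2) u := by
  have hu2 : u / 2 ≠ 0 := by positivity
  rw [besselI_eq_rpow_mul hμ hu.le, besselI_eq_rpow_mul (by linarith : 0 < μ + 1) hu.le,
    besselI_eq_rpow_mul (by linarith : 0 < μ + 2) hu.le, besselEntire_recurrence hμ,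
    Real.rpow_add_one hu2, show μ + 2 = μ + 1 + 1 by ring, Real.rpow_add_one hu2,
    Real.rpow_add_one hu2]
  field_simp

/-- The Euler derivative `u I_μ'(u)`, written without differentiation. -/
noncomputable def besselEuler (μ u : ℝ) : ℝ := μ * besselI μ u + u * besselI (μ + 1) u

lemma hasDerivAt_besselI_euler {μ : ℝ} (hμ : 0 < μ) {u : ℝ} (hu : 0 < u) :
    HasDerivAt (besselI μ) (besselEuler μ u / u) u := by
  refine (hasDerivAt_besselI hμ hu).congr_deriv ?_
  rw [besselEuler]
  field_simp

lemma hasDerivAt_besselEuler {μ : ℝ} (hμ : 0 < μ) {u : ℝ} (hu : 0 < u) :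
    HasDerivAt (besselEuler μ) ((u ^ 2 + μ ^ 2) * besselI μ u / u) u := by
  have h1 := hasDerivAt_besselI (by linarith : 0 < μ + 1) hu
  refine (((hasDerivAt_besselI hμ hu).const_mul μ).add ((hasDerivAt_id u).mul h1)).congr_deriv ?_
  have hrec := besselI_recurrence hμ hu
  rw [show μ + 1 + 1 = μ + 2 by ring,
    show besselI (μ + 2) u = besselI μ u - 2 * (μ + 1) / u * besselI (μ + 1) u by linarith]
  simp only [id_eq]
  field_simp
  ring

lemma mul_besselI_lt_besselEuler {μ : ℝ} (hμ : 0 < μ) {u : ℝ} (hu : 0 < u) :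
    μ * besselI μ u < besselEuler μ u := by
  have := besselI_pos (by linarith : 0 < μ + 1) hu
  rw [besselEuler]
  nlinarith [mul_pos hu this]

/-- The lower bound `(u I_μ'(u) / I_μ(u))² > μ u² / (μ + 1) + μ²`. -/
lemma besselI_sq_lt_besselEuler_sq {μ : ℝ} (hμ : 0 < μ) {u : ℝ} (hu : 0 < u) :
    (μ * u ^ 2 / (μ + 1) + μ ^ 2) * besselI μ u ^ 2 < besselEuler μ u ^ 2 := by
  let F : ℝ → ℝ := fun v =>
    besselEuler μ v ^ 2 - (μ / (μ + 1) * v ^ 2 + μ ^ 2) * besselI μ v ^ 2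
  have hI := continuousOn_besselI hμ
  have hK := continuousOn_besselI (by linarith : 0 < μ + 1)
  have hcont : ContinuousOn F (Ici 0) := by
    have hJ : ContinuousOn (besselEuler μ) (Ici 0) :=
      (hI.const_smul μ).add (continuousOn_id.mul hK)
    fun_prop
  have hmono : StrictMonoOn F (Ici 0) := by
    refine strictMonoOn_of_deriv_pos (convex_Ici 0) hcont fun v hv => ?_
    rw [interior_Ici] at hv
    have hv : 0 < v := hv
    have hd : HasDerivAt F
        (2 * v * besselI μ v * (besselEuler μ v - μ * besselI μ v) / (μ + 1)) v := by
      refine (((hasDerivAt_besselEuler hμ hv).pow 2).sub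
        ((((hasDerivAt_pow 2 v).const_mul (μ / (μ + 1))).add_const (μ ^ 2)).mul
          ((hasDerivAt_besselI_euler hμ hv).pow 2))).congr_deriv ?_
      have : μ + 1 ≠ 0 := by positivity
      simp only [Pi.pow_apply]
      field_simp
      push_cast
      ring
    rw [hd.deriv]
    have h1 := besselI_pos hμ hv
    have h2 := sub_pos.2 (mul_besselI_lt_besselEuler hμ hv)
    positivity
  have h := hmono (self_mem_Ici (a := (0 : ℝ))) hu.le hu
  have hzero : F 0 = 0 := by simp [F, besselEuler, besselI_zero hμ]
  rw [hzero] at h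
  have e : μ * u ^ 2 / (μ + 1) = μ / (μ + 1) * u ^ 2 := by ring
  rw [e]
  exact sub_pos.1 h

lemma quadratic_nonneg_of_cubic {p q ν y : ℝ} (hp : p ≤ 0) (hq : q < 0) (hν : -1 / q ≤ ν)
    (hcubic : 0 ≤ 4 * q * (q - 1) * ν ^ 3 - (p ^ 2 - 4 * (q - 1)) * ν ^ 2 - 2 * p ^ 2 * ν - p ^ 2)
    (hy : ν ≤ y) :
    0 ≤ (-q * ν - 1) * y ^ 2 + p * ν * y + ν ^ 2 := by
  have hν0 : 0 < ν := (div_pos_of_neg_of_neg (by norm_num) hq).trans_le hν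
  obtain ⟨c, rfl⟩ : ∃ c, q = -c := ⟨-q, by ring⟩
  obtain ⟨b, rfl⟩ : ∃ b, p = -b := ⟨-p, by ring⟩
  have hc : 0 < c := by linarith
  have hb : 0 ≤ b := by linarith
  have hd : 0 ≤ c * ν - 1 := by
    rw [neg_div_neg_eq, div_le_iff₀ hc] at hν
    linarith
  have hsq : (b * (ν + 1)) ^ 2 ≤ 4 * (1 + c) * (c * ν - 1) * ν ^ 2 := by linarith
  have hbc : b ≤ c * ν := by
    have h : (b * (ν + 1)) ^ 2 ≤ (c * ν * (ν + 1)) ^ 2 := by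
      nlinarith [sq_nonneg (ν * (c * (ν - 1) - 2))]
    exact le_of_mul_le_mul_right ((sq_le_sq₀ (by positivity) (by positivity)).1 h) (by linarith)
  rcases le_or_gt b (2 * (c * ν - 1)) with h | h
  · nlinarith [mul_nonneg hd (sq_nonneg (y - ν)),
      mul_nonneg (mul_nonneg hν0.le (sub_nonneg.2 hy)) (sub_nonneg.2 h),
      mul_nonneg (sq_nonneg ν) (sub_nonneg.2 hbc)]
  · have hcν : c * ν < 2 := by linarith
    have hbd : b ^ 2 ≤ 4 * (c * ν - 1) := by
      have h1 : (1 + c) * ν ^ 2 ≤ (ν + 1) ^ 2 := by nlinarith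
      have h2 : b ^ 2 * (ν + 1) ^ 2 ≤ 4 * (c * ν - 1) * (ν + 1) ^ 2 := by
        nlinarith [mul_le_mul_of_nonneg_left h1 hd]
      exact le_of_mul_le_mul_right h2 (by positivity)
    have hy0 : 0 ≤ y := by linarith
    nlinarith [sq_nonneg (b * y - 2 * ν), mul_nonneg (sub_nonneg.2 hbd) (sq_nonneg y)]

lemma besselI_quadratic_neg {p q ν u : ℝ} (hp : p ≤ 0) (hq : q < 0) (hν : -1 / q ≤ ν)
    (hcubic : 0 ≤ 4 * q * (q - 1) * ν ^ 3 - (p ^ 2 - 4 * (q - 1)) * ν ^ 2 - 2 * p ^ 2 * ν - p ^ 2)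
    (hu : 0 < u) :
    -p * besselEuler ν u * besselI ν u + (u ^ 2 + ν ^ 2) * besselI ν u ^ 2
      + (q - 1) * besselEuler ν u ^ 2 < 0 := by
  have hν0 : 0 < ν := (div_pos_of_neg_of_neg (by norm_num) hq).trans_le hν
  have hI := besselI_pos hν0 hu
  have hlt := mul_besselI_lt_besselEuler hν0 hu
  have hF := besselI_sq_lt_besselEuler_sq hν0 hu
  obtain ⟨y, hy⟩ : ∃ y, besselEuler ν u = y * besselI ν u :=
    ⟨besselEuler ν u / besselI ν u, by field_simp⟩
  rw [hy] at hlt hF ⊢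
  have hlt := lt_of_mul_lt_mul_right hlt hI.le
  rw [mul_pow] at hF
  have hF := lt_of_mul_lt_mul_right hF (sq_nonneg _)
  have hF' : ν * u ^ 2 < (y ^ 2 - ν ^ 2) * (ν + 1) := by
    rw [← div_lt_iff₀ (by linarith)]
    linarith
  have hQ := quadratic_nonneg_of_cubic hp hq hν hcubic hlt.le
  have hneg : -p * y + (u ^ 2 + ν ^ 2) + (q - 1) * y ^ 2 < 0 := by
    refine neg_of_mul_neg_right (a := ν) ?_ hν0.le
    linarith
  have := mul_neg_of_neg_of_pos hneg (pow_pos hI 2)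
  linarith

theorem besselI_pq_concave (p q ν : ℝ) (hp : p ≤ 0) (hq : q < 0) (hν : -1 / q ≤ ν)
    (hcubic : 0 ≤ 4 * q * (q - 1) * ν ^ 3 - (p ^ 2 - 4 * (q - 1)) * ν ^ 2 - 2 * p ^ 2 * ν - p ^ 2) :
    StrictAntiOn (fun u : ℝ => u ^ (1 - p) * deriv (besselI ν) u * (besselI ν u) ^ (q - 1))
      (Ioi 0) := by
  have hν0 : 0 < ν := (div_pos_of_neg_of_neg (by norm_num) hq).trans_le hν
  have heq : EqOn (fun u : ℝ => u ^ (-p) * besselEuler ν u * besselI ν u ^ (q - 1))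
      (fun u : ℝ => u ^ (1 - p) * deriv (besselI ν) u * (besselI ν u) ^ (q - 1)) (Ioi 0) := by
    intro u hu
    have hu : 0 < u := hu
    simp only
    rw [(hasDerivAt_besselI_euler hν0 hu).deriv, show 1 - p = -p + 1 by ring,
      Real.rpow_add_one hu.ne']
    field_simp
  have hderiv (u : ℝ) (hu : 0 < u) :
      HasDerivAt (fun u : ℝ => u ^ (-p) * besselEuler ν u * besselI ν u ^ (q - 1))
        (u ^ (-p - 1) * besselI ν u ^ (q - 1 - 1) *
          (-p * besselEuler ν u * besselI ν u + (u ^ 2 + ν ^ 2) * besselI ν u ^ 2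
            + (q - 1) * besselEuler ν u ^ 2)) u := by
    have hI := besselI_pos hν0 hu
    refine (((Real.hasDerivAt_rpow_const (p := -p) (Or.inl hu.ne')).mul
      (hasDerivAt_besselEuler hν0 hu)).mul
        ((hasDerivAt_besselI_euler hν0 hu).rpow_const (p := q - 1)
          (Or.inl hI.ne'))).congr_deriv ?_
    simp only [Pi.mul_apply, Real.rpow_sub_one hu.ne', Real.rpow_sub_one hI.ne']
    field_simp
  refine StrictAntiOn.congr ?_ heq
  refine strictAntiOn_of_deriv_neg (convex_Ioi 0)
    (fun u hu => (hderiv u hu).continuousAt.continuousWithinAt) fun u hu => ?_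
  rw [interior_Ioi] at hu
  have hu : 0 < u := hu
  rw [(hderiv u hu).deriv]
  have hI := besselI_pos hν0 hu
  exact mul_neg_of_pos_of_neg (by positivity) (besselI_quadratic_neg hp hq hν hcubic hu)
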